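/- Let S_j = V_j ⊗ I + I ⊗ W_j for j = 1,…,N. Then the following operator identity holds on 𝓗_A ⊗ 𝓗_B: −i(H^A ⊗ I + I ⊗ H^B + 2λ_0 I⊗I) − (1/2)·Σ_{j=1}^N (V_j*V_j ⊗ I + I ⊗ W_j*W_j + 2 V_j ⊗ W_j*) = −i(H^A ⊗ I + I ⊗ H^B + (i/2)·Σ_{j=1}^N (V_j* ⊗ W_j − V_j ⊗ W_j*) + 2λ_0 I⊗I) − (1/2)·Σ_{j=1}^N S_j* S_j. (This identity identifies the effective interaction Hamiltonian (i/2)·Σ_j (V_j* ⊗ W_j − V_j ⊗ W_j*) created between the two non-interacting systems by the repeated interactions with the environment.) -/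

import Mathlib

open Matrix Kronecker

/-- Expansion of `S* S` for `S = V ⊗ I + I ⊗ W`. -/
theorem conjTranspose_mul_self_kronecker_add {m n : Type*} [Fintype m] [Fintype n]
    [DecidableEq m] [DecidableEq n] (V : Matrix m m ℂ) (W : Matrix n n ℂ) :
    (V ⊗ₖ (1 : Matrix n n ℂ) + (1 : Matrix m m ℂ) ⊗ₖ W)ᴴ
        * (V ⊗ₖ (1 : Matrix n n ℂ) + (1 : Matrix m m ℂ) ⊗ₖ W)
      = ((Vᴴ * V) ⊗ₖ (1 : Matrix n n ℂ) + (1 : Matrix m m ℂ) ⊗ₖ (Wᴴ * W)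
          + (2 : ℂ) • (V ⊗ₖ Wᴴ))
        + (Vᴴ ⊗ₖ W - V ⊗ₖ Wᴴ) := by
  simp only [conjTranspose_add, conjTranspose_kronecker, conjTranspose_one, add_mul, mul_add,
    ← mul_kronecker_mul, one_mul, mul_one]
  module

/-- The generator identity identifying the effective interaction
Hamiltonian `(i/2) Σⱼ (Vⱼ* ⊗ Wⱼ − Vⱼ ⊗ Wⱼ*)` created between the two non-interacting
systems by the repeated interactions with the environment. -/
theorem effective_interaction_hamiltonian_identity
    (N dA dB : ℕ) (hN : 1 ≤ N)
    (HA : Matrix (Fin dA) (Fin dA) ℂ) (HB : Matrix (Fin dB) (Fin dB) ℂ)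
    (hHA : HA.IsHermitian) (hHB : HB.IsHermitian)
    (lam0 : ℝ)
    (V : Fin N → Matrix (Fin dA) (Fin dA) ℂ)
    (W : Fin N → Matrix (Fin dB) (Fin dB) ℂ)
    (S : Fin N → Matrix (Fin dA × Fin dB) (Fin dA × Fin dB) ℂ)
    (hS : ∀ j, S j = (V j) ⊗ₖ (1 : Matrix (Fin dB) (Fin dB) ℂ)
        + (1 : Matrix (Fin dA) (Fin dA) ℂ) ⊗ₖ (W j)) :
    (-Complex.I) • (HA ⊗ₖ (1 : Matrix (Fin dB) (Fin dB) ℂ)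
        + (1 : Matrix (Fin dA) (Fin dA) ℂ) ⊗ₖ HB
        + ((2 * lam0 : ℝ) : ℂ) • (1 : Matrix (Fin dA × Fin dB) (Fin dA × Fin dB) ℂ))
      - (1/2 : ℂ) • ∑ j : Fin N,
          (((V j)ᴴ * V j) ⊗ₖ (1 : Matrix (Fin dB) (Fin dB) ℂ)
            + (1 : Matrix (Fin dA) (Fin dA) ℂ) ⊗ₖ ((W j)ᴴ * W j)
            + (2 : ℂ) • ((V j) ⊗ₖ (W j)ᴴ))
    =
    (-Complex.I) • (HA ⊗ₖ (1 : Matrix (Fin dB) (Fin dB) ℂ)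
        + (1 : Matrix (Fin dA) (Fin dA) ℂ) ⊗ₖ HB
        + (Complex.I / 2) • ∑ j : Fin N, ((V j)ᴴ ⊗ₖ (W j) - (V j) ⊗ₖ (W j)ᴴ)
        + ((2 * lam0 : ℝ) : ℂ) • (1 : Matrix (Fin dA × Fin dB) (Fin dA × Fin dB) ℂ))
      - (1/2 : ℂ) • ∑ j : Fin N, (S j)ᴴ * S j := by
  simp only [hS, conjTranspose_mul_self_kronecker_add, Finset.sum_add_distrib (g := fun j =>
    (V j)ᴴ ⊗ₖ (W j) - (V j) ⊗ₖ (W j)ᴴ)]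
  have hI : (-Complex.I) * (Complex.I / 2) = 1 / 2 := by
    linear_combination (-1 / 2 : ℂ) * Complex.I_mul_I
  simp only [smul_add, smul_smul, hI]
  abel
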